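/- The correlation function of the stationary fractional Ornstein-Uhlenbeck process with Hurst exponent H ∈ (0,1/2) admits the spectral representation C_Z(s) = (2 sin(πH)/π) ∫_0^∞ cos(sx) x^{1−2H}/(1+x²) dx, and equals (1/Γ(2H+1)) [ (1/2)∫_ℝ e^{−|v|} |s+v|^{2H} dv − |s|^{2H} ]. -/

import Mathlib

open MeasureTheory Real

/-- Tonelli theorem for nonnegative functions with known partial integrals: integrability of one
partial integral gives that of the other, and their integrals agree. -/
lemma integrableOn_and_setIntegral_swap_of_nonneg {f : ℝ → ℝ → ℝ} {F G : ℝ → ℝ} {s t : Set ℝ}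
    (hs : MeasurableSet s) (ht : MeasurableSet t) (hf : Measurable (Function.uncurry f))
    (hf0 : ∀ x ∈ s, ∀ y ∈ t, 0 ≤ f x y) (hfi : ∀ x ∈ s, IntegrableOn (f x) t)
    (hF : ∀ x ∈ s, ∫ y in t, f x y = F x) (hFi : IntegrableOn F s)
    (hG : ∀ y ∈ t, ∫ x in s, f x y = G y) :
    IntegrableOn G t ∧ ∫ y in t, G y = ∫ x in s, F x := by
  have hprod : Integrable (Function.uncurry f)
      ((volume.restrict s).prod (volume.restrict t)) := by
    refine (integrable_prod_iff hf.aestronglyMeasurable).2 ⟨?_, ?_⟩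
    · filter_upwards [ae_restrict_mem hs] with x hx using hfi x hx
    · refine hFi.congr_fun (fun x hx => ?_) hs
      rw [← hF x hx]
      refine setIntegral_congr_fun ht fun y hy => ?_
      simp [Function.uncurry, abs_of_nonneg (hf0 x hx y hy)]
  refine ⟨IntegrableOn.congr_fun (f := fun y => ∫ x in s, f x y) hprod.integral_prod_right
    hG ht, ?_⟩
  rw [← setIntegral_congr_fun ht hG, ← setIntegral_congr_fun hs hF]
  exact (integral_integral_swap hprod).symm

lemma integrableOn_exp_neg_mul_mul_cos {b : ℝ} (hb : 0 < b) (c : ℝ) :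
    IntegrableOn (fun x => exp (-b * x) * cos (c * x)) (Set.Ioi 0) := by
  refine (integrableOn_exp_mul_Ioi (neg_lt_zero.2 hb) 0).mono' (by fun_prop)
    (.of_forall fun x => ?_)
  rw [norm_mul, norm_of_nonneg (exp_pos _).le]
  exact mul_le_of_le_one_right (exp_pos _).le (abs_cos_le_one _)

lemma integral_exp_neg_mul_mul_cos {b : ℝ} (hb : 0 < b) (c : ℝ) :
    ∫ x in Set.Ioi (0 : ℝ), exp (-b * x) * cos (c * x) = b / (b ^ 2 + c ^ 2) := by
  have hre : (-b + c * Complex.I : ℂ).re < 0 := by simpa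
  have h := integral_exp_mul_complex_Ioi hre 0
  have h2 := integral_re (𝕜 := ℂ) (integrableOn_exp_mul_complex_Ioi hre 0)
  rw [h] at h2
  have : ∀ x : ℝ, RCLike.re (Complex.exp ((-b + c * Complex.I) * x)) =
      exp (-b * x) * cos (c * x) := fun x => by
    simp [Complex.exp_re]
  simp_rw [this] at h2
  rw [h2]
  simp [Complex.div_re, Complex.normSq_apply, sq]

lemma integral_exp_neg_abs_mul_cos (c : ℝ) :
    ∫ v : ℝ, exp (-|v|) * cos (c * v) = 2 / (1 + c ^ 2) := by
  have h : ∀ v : ℝ, cos (c * v) = cos (c * |v|) := fun v => by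
    rcases abs_choice v with h | h <;> simp [h]
  rw [integral_congr_ae (.of_forall fun v => congrArg (exp (-|v|) * ·) (h v)),
    integral_comp_abs (f := fun v => exp (-v) * cos (c * v))]
  have := integral_exp_neg_mul_mul_cos one_pos c
  simp only [neg_mul, one_mul, one_pow] at this
  rw [this]; ring

lemma integrable_exp_neg_mul_abs {b : ℝ} (hb : 0 < b) : Integrable fun v : ℝ => exp (-b * |v|) := by
  refine .of_integral_ne_zero ?_
  rw [integral_comp_abs (f := fun v => exp (-b * v)), integral_exp_mul_Ioi (neg_lt_zero.2 hb)]
  simp [hb.ne']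

lemma integrable_exp_neg_abs_mul_bounded {g : ℝ → ℝ} (hg : Continuous g) {C : ℝ}
    (hC : ∀ v, |g v| ≤ C) : Integrable fun v : ℝ => exp (-|v|) * g v := by
  have h := integrable_exp_neg_mul_abs one_pos
  simp only [neg_mul, one_mul] at h
  exact h.mul_bdd hg.aestronglyMeasurable (.of_forall hC)

lemma integral_exp_neg_abs_mul_sin (c : ℝ) : ∫ v : ℝ, exp (-|v|) * sin (c * v) = 0 := by
  have h := integral_neg_eq_self (fun v : ℝ => exp (-|v|) * sin (c * v)) volume
  simp only [abs_neg, mul_neg, sin_neg, integral_neg] at h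
  linarith

lemma integral_exp_neg_abs_mul_one_sub_cos (s x : ℝ) :
    ∫ v : ℝ, exp (-|v|) * (1 - cos ((s + v) * x)) = 2 * (1 - cos (s * x) / (1 + x ^ 2)) := by
  have h1 := integral_exp_neg_abs_mul_cos 0
  have hc := integral_exp_neg_abs_mul_cos x
  have hs := integral_exp_neg_abs_mul_sin x
  have i1 := integrable_exp_neg_abs_mul_bounded (g := fun _ => cos (0 * (0:ℝ))) (by fun_prop)
    (fun _ => abs_cos_le_one _)
  have ic := integrable_exp_neg_abs_mul_bounded (g := fun v => cos (x * v)) (by fun_prop)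
    (fun _ => abs_cos_le_one _)
  have is := integrable_exp_neg_abs_mul_bounded (g := fun v => sin (x * v)) (by fun_prop)
    (fun _ => abs_sin_le_one _)
  simp only [zero_mul, cos_zero] at h1 i1
  have : ∀ v : ℝ, exp (-|v|) * (1 - cos ((s + v) * x)) = exp (-|v|) * 1 -
      cos (s * x) * (exp (-|v|) * cos (x * v)) + sin (s * x) * (exp (-|v|) * sin (x * v)) := by
    intro v
    rw [add_mul, cos_add, mul_comm v x]; ring
  simp_rw [this]
  rw [integral_add (by exact i1.sub (ic.const_mul _)) (is.const_mul _),
    integral_sub i1 (ic.const_mul _),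
    integral_const_mul, integral_const_mul, h1, hc, hs]
  ring

lemma integrable_exp_neg_abs_mul_abs_add_rpow {a : ℝ} (ha0 : 0 ≤ a) (ha1 : a ≤ 1) (s : ℝ) :
    Integrable fun v : ℝ => exp (-|v|) * |s + v| ^ a := by
  refine ((integrable_exp_neg_mul_abs (half_pos one_pos)).const_mul (2 * exp (|s| / 2))).mono'
    (by fun_prop) (.of_forall fun v => ?_)
  rw [norm_of_nonneg (by positivity)]
  have h1 : |s + v| ^ a ≤ 1 + |s + v| := by
    refine (rpow_le_rpow (abs_nonneg _) (by linarith) ha0 :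
      |s + v| ^ a ≤ (1 + |s + v|) ^ a).trans ?_
    exact (rpow_le_rpow_of_exponent_le (by linarith [abs_nonneg (s + v)]) ha1).trans_eq
      (rpow_one _)
  have h2 : 1 + |s + v| ≤ 2 * exp (|s| / 2 + |v| / 2) := by
    linarith [add_one_le_exp (|s| / 2 + |v| / 2), abs_add_le s v]
  calc exp (-|v|) * |s + v| ^ a ≤ exp (-|v|) * (2 * exp (|s| / 2 + |v| / 2)) := by
        gcongr; exact h1.trans h2
    _ = 2 * exp (|s| / 2) * exp (-(1 / 2) * |v|) := by
        rw [mul_left_comm, mul_assoc, ← exp_add, ← exp_add]; ring_nf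

lemma integrableOn_and_integral_rpow_div_one_add_sq {a : ℝ} (ha0 : 0 < a) (ha2 : a < 2) :
    IntegrableOn (fun t : ℝ => t ^ (a - 1) / (1 + t ^ 2)) (Set.Ioi 0) ∧
      ∫ t in Set.Ioi (0 : ℝ), t ^ (a - 1) / (1 + t ^ 2) = π / (2 * sin (π * a / 2)) := by
  have key := integrableOn_and_setIntegral_swap_of_nonneg
    (f := fun y t => exp (-y) * (t ^ (a - 1) * exp (-y * t ^ 2)))
    (F := fun y => (exp (-y) * y ^ ((1 - a / 2) - 1)) * (1 / 2 * Gamma (a / 2)))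
    (G := fun t => t ^ (a - 1) / (1 + t ^ 2))
    (s := Set.Ioi 0) (t := Set.Ioi 0) measurableSet_Ioi measurableSet_Ioi (by fun_prop)
    (fun y hy t ht => by
      have : (0 : ℝ) < t := ht
      positivity)
    (fun y hy => (integrableOn_rpow_mul_exp_neg_mul_sq hy (by linarith)).const_mul _)
    (fun y hy => by
      have h := integral_rpow_mul_exp_neg_mul_rpow (p := 2) (q := a - 1) two_pos
        (by linarith) (show 0 < y from hy)
      simp only [rpow_two] at h
      rw [integral_const_mul, h]
      ring_nf)
    ((GammaIntegral_convergent (by linarith)).mul_const _)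
    (fun t ht => by
      have h := integral_exp_mul_Ioi (a := -(1 + t ^ 2)) (by nlinarith [sq_nonneg t]) 0
      have : ∀ y : ℝ, exp (-y) * (t ^ (a - 1) * exp (-y * t ^ 2)) =
          t ^ (a - 1) * exp (-(1 + t ^ 2) * y) := fun y => by
        rw [mul_left_comm, ← exp_add]; ring_nf
      simp_rw [this]
      rw [integral_const_mul, h]
      rw [mul_zero, exp_zero, neg_div_neg_eq, mul_one_div])
  refine ⟨key.1, key.2.trans ?_⟩
  rw [integral_mul_const, ← Gamma_eq_integral (by linarith)]
  have := Gamma_mul_Gamma_one_sub (a / 2)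
  rw [mul_div_assoc]
  rw [show Gamma (1 - a / 2) * (1 / 2 * Gamma (a / 2)) =
    1 / 2 * (Gamma (a / 2) * Gamma (1 - a / 2)) by ring, this]
  field_simp

lemma integrableOn_and_integral_one_sub_cos_mul_rpow {a : ℝ} (ha0 : 0 < a) (ha2 : a < 2) :
    IntegrableOn (fun x : ℝ => (1 - cos x) * x ^ (-1 - a)) (Set.Ioi 0) ∧
      ∫ x in Set.Ioi (0 : ℝ), (1 - cos x) * x ^ (-1 - a) =
        π / (2 * Gamma (a + 1) * sin (π * a / 2)) := by
  have hG : 0 < Gamma (a + 1) := Gamma_pos_of_pos (by linarith)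
  obtain ⟨hi, hv⟩ := integrableOn_and_integral_rpow_div_one_add_sq ha0 ha2
  have key := integrableOn_and_setIntegral_swap_of_nonneg
    (f := fun t x => t ^ a * (exp (-t * x) * cos (0 * x) - exp (-t * x) * cos (1 * x)))
    (F := fun t => t ^ (a - 1) / (1 + t ^ 2))
    (G := fun x => Gamma (a + 1) * ((1 - cos x) * x ^ (-1 - a)))
    (s := Set.Ioi 0) (t := Set.Ioi 0) measurableSet_Ioi measurableSet_Ioi (by fun_prop)
    (fun t ht x hx => by
      have : (0 : ℝ) < t := ht
      rw [← mul_sub, zero_mul, cos_zero]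
      have := sub_nonneg.2 (cos_le_one (1 * x))
      positivity)
    (fun t ht => ((integrableOn_exp_neg_mul_mul_cos ht 0).sub
      (integrableOn_exp_neg_mul_mul_cos ht 1)).const_mul _)
    (fun t ht => by
      have ht' : (0 : ℝ) < t := ht
      rw [integral_const_mul, integral_sub (integrableOn_exp_neg_mul_mul_cos ht 0)
        (integrableOn_exp_neg_mul_mul_cos ht 1), integral_exp_neg_mul_mul_cos ht,
        integral_exp_neg_mul_mul_cos ht, rpow_sub_one ht'.ne']
      have : 1 + t ^ 2 ≠ 0 := by positivity
      field_simp
      ring)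
    hi
    (fun x hx => by
      have hx' : (0 : ℝ) < x := hx
      have h := integral_rpow_mul_exp_neg_mul_Ioi (a := a + 1) (by linarith) hx'
      have : ∀ t : ℝ, t ^ a * (exp (-t * x) * cos (0 * x) - exp (-t * x) * cos (1 * x)) =
          (1 - cos x) * (t ^ (a + 1 - 1) * exp (-(x * t))) := fun t => by
        simp only [zero_mul, cos_zero, one_mul, add_sub_cancel_right, neg_mul, mul_comm x t]; ring
      simp_rw [this]
      rw [integral_const_mul, h, one_div, inv_rpow hx'.le, ← rpow_neg hx'.le, neg_add']
      ring_nf)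
  refine ⟨?_, ?_⟩
  · refine IntegrableOn.congr_fun (key.1.const_mul (Gamma (a + 1))⁻¹) (fun x _ => ?_)
      measurableSet_Ioi
    field_simp
  · have h := key.2
    rw [integral_const_mul, hv] at h
    rw [← mul_right_inj' hG.ne', h]
    field_simp

/-- The Lévy-Khintchine representation of `|y| ^ a`. -/
lemma integrableOn_and_integral_one_sub_cos_mul_mul_rpow {a : ℝ} (ha0 : 0 < a) (ha2 : a < 2)
    (y : ℝ) :
    IntegrableOn (fun x : ℝ => (1 - cos (y * x)) * x ^ (-1 - a)) (Set.Ioi 0) ∧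
      ∫ x in Set.Ioi (0 : ℝ), (1 - cos (y * x)) * x ^ (-1 - a) =
        |y| ^ a * (π / (2 * Gamma (a + 1) * sin (π * a / 2))) := by
  obtain ⟨hi, hv⟩ := integrableOn_and_integral_one_sub_cos_mul_rpow ha0 ha2
  rcases eq_or_ne y 0 with rfl | hy
  · simp [zero_rpow ha0.ne']
  have hy' : 0 < |y| := abs_pos.2 hy
  have hEq : Set.EqOn (fun x : ℝ => |y| ^ (1 + a) * ((1 - cos (|y| * x)) * (|y| * x) ^ (-1 - a)))
      (fun x => (1 - cos (y * x)) * x ^ (-1 - a)) (Set.Ioi 0) := fun x hx => by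
    have hx' : (0 : ℝ) < x := hx
    have hc : cos (|y| * x) = cos (y * x) := by
      rcases abs_choice y with h | h <;> simp [h]
    have hp : |y| ^ (1 + a) * |y| ^ (-1 - a) = 1 := by
      rw [← rpow_add hy']; simp
    simp only [mul_rpow hy'.le hx'.le, hc]
    linear_combination (1 - cos (y * x)) * x ^ (-1 - a) * hp
  refine ⟨?_, ?_⟩
  · refine IntegrableOn.congr_fun (Integrable.const_mul ?_ _) hEq measurableSet_Ioi
    exact (integrableOn_Ioi_comp_mul_left_iff (fun x : ℝ => (1 - cos x) * x ^ (-1 - a)) 0 hy').2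
      (by simpa using hi)
  · rw [← setIntegral_congr_fun measurableSet_Ioi hEq, integral_const_mul,
      integral_comp_mul_left_Ioi (fun x : ℝ => (1 - cos x) * x ^ (-1 - a)) 0 hy', mul_zero, hv,
      smul_eq_mul, ← mul_assoc, add_comm, rpow_add_one hy'.ne']
    field_simp

/-- the two explicit formulas for the correlation function of the stationary
fractional Ornstein-Uhlenbeck process with Hurst exponent `H ∈ (0,1/2)` agree:
`(2 sin(πH)/π) ∫_0^∞ cos(sx) x^{1-2H}/(1+x²) dx
  = (1/Γ(2H+1)) [ (1/2)∫_ℝ e^{-|v|} |s+v|^{2H} dv - |s|^{2H} ]`. -/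
theorem fou_correlation_spectral_representation
    (H : ℝ) (hH : H ∈ Set.Ioo (0 : ℝ) (1/2)) (s : ℝ) :
    (2 * Real.sin (Real.pi * H) / Real.pi)
        * ∫ x in Set.Ioi (0 : ℝ), Real.cos (s * x) * x ^ (1 - 2 * H) / (1 + x ^ 2)
      = (Real.Gamma (2 * H + 1))⁻¹
        * ((1 / 2) * (∫ v : ℝ, Real.exp (-|v|) * |s + v| ^ (2 * H)) - |s| ^ (2 * H)) := by
  obtain ⟨hH0, hH1⟩ := hH
  have hG : 0 < Gamma (2 * H + 1) := Gamma_pos_of_pos (by linarith)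
  have hsin : 0 < sin (π * H) := sin_pos_of_pos_of_lt_pi (by positivity) (by nlinarith [pi_pos])
  have hpi := pi_pos
  have hK := integrableOn_and_integral_one_sub_cos_mul_mul_rpow (a := 2 * H)
    (by linarith) (by linarith)
  rw [show π * (2 * H) / 2 = π * H by ring] at hK
  set K := π / (2 * Gamma (2 * H + 1) * sin (π * H)) with hKdef
  have key := integrableOn_and_setIntegral_swap_of_nonneg
    (f := fun v x => exp (-|v|) * ((1 - cos ((s + v) * x)) * x ^ (-1 - 2 * H)))
    (F := fun v => exp (-|v|) * |s + v| ^ (2 * H) * K)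
    (G := fun x => 2 * (1 - cos (s * x) / (1 + x ^ 2)) * x ^ (-1 - 2 * H))
    (s := Set.univ) (t := Set.Ioi 0) MeasurableSet.univ measurableSet_Ioi (by fun_prop)
    (fun v _ x hx => by
      have : (0 : ℝ) < x := hx
      have := sub_nonneg.2 (cos_le_one ((s + v) * x))
      positivity)
    (fun v _ => (hK (s + v)).1.const_mul _)
    (fun v _ => by rw [integral_const_mul, (hK (s + v)).2, mul_assoc])
    (((integrable_exp_neg_abs_mul_abs_add_rpow (by linarith) (by linarith) s).mul_const
      K).integrableOn)
    (fun x _ => by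
      simp_rw [← mul_assoc]
      rw [integral_mul_const, setIntegral_univ, integral_exp_neg_abs_mul_one_sub_cos])
  have hEq : Set.EqOn (fun x : ℝ => cos (s * x) * x ^ (1 - 2 * H) / (1 + x ^ 2))
      (fun x => 1 / 2 * (2 * (1 - cos (s * x) / (1 + x ^ 2)) * x ^ (-1 - 2 * H)) -
        (1 - cos (s * x)) * x ^ (-1 - 2 * H)) (Set.Ioi 0) := fun x hx => by
    have hx' : (0 : ℝ) < x := hx
    have hp : x ^ (1 - 2 * H) = x ^ 2 * x ^ (-1 - 2 * H) := by
      rw [← rpow_two, ← rpow_add hx']; ring_nf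
    have : 1 + x ^ 2 ≠ 0 := by positivity
    simp only [hp]
    field_simp
    ring
  rw [setIntegral_congr_fun measurableSet_Ioi hEq, integral_sub (key.1.const_mul _) (hK s).1,
    integral_const_mul, key.2, (hK s).2, setIntegral_univ, integral_mul_const, hKdef]
  field_simp
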